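/- In the equitable algebra U, for i ≠ j one has Σ_{r=0}^{1-A_ij} (-1)^r [1-A_ij choose r]_i (Y_i - X_i^{-1})^{1-A_ij-r} (Y_j - X_j^{-1}) (Y_i - X_i^{-1})^{r} = 0. -/

import Mathlib

open FreeAlgebra
open scoped TensorProduct

noncomputable section

/-- The field `𝕂(q)` of rational functions in the indeterminate `q` over `𝕂`. -/
abbrev Kq (K : Type) [Field K] : Type := RatFunc K

/-- The indeterminate `q` viewed as an element of `𝕂(q)`. -/
def qv (K : Type) [Field K] : Kq K := RatFunc.X

/-- `q_i = q^{d_i}`, given the exponent `di = d_i`. -/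
def qi (K : Type) [Field K] (di : ℕ) : Kq K := qv K ^ di

/-- The quantum integer `[m]_i = (q_i^m - q_i^{-m})/(q_i - q_i⁻¹)`. -/
def qnum (K : Type) [Field K] (di : ℕ) (m : ℤ) : Kq K :=
  (qi K di ^ m - qi K di ^ (-m)) / (qi K di - (qi K di)⁻¹)

/-- The quantum factorial `[m]_i! = [m]_i [m-1]_i ⋯ [1]_i`, with `[0]_i! = 1`. -/
def qfac (K : Type) [Field K] (di : ℕ) : ℕ → Kq K
  | 0 => 1
  | m + 1 => qnum K di (m + 1) * qfac K di m

/-- The Gaussian binomial coefficient `[m choose r]_i = [m]_i!/([r]_i![m-r]_i!)`. -/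
def qbin (K : Type) [Field K] (di m r : ℕ) : Kq K :=
  qfac K di m / (qfac K di r * qfac K di (m - r))

/-- Chevalley generators `E_i, F_i, K_i, K_i⁻¹` of `U_q(g)`. -/
inductive CGen (n : ℕ) : Type
  | E : Fin n → CGen n
  | F : Fin n → CGen n
  | K : Fin n → CGen n
  | Kinv : Fin n → CGen n

/-- The defining relations (R1)–(R7) of `U_q(g)` in the Chevalley presentation. -/
inductive CRel (K : Type) [Field K] {n : ℕ} (A : Matrix (Fin n) (Fin n) ℤ) (d : Fin n → ℕ) :
    FreeAlgebra (Kq K) (CGen n) → FreeAlgebra (Kq K) (CGen n) → Prop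
  | R1a (i : Fin n) : CRel K A d (ι (Kq K) (CGen.K i) * ι (Kq K) (CGen.Kinv i)) 1
  | R1b (i : Fin n) : CRel K A d (ι (Kq K) (CGen.Kinv i) * ι (Kq K) (CGen.K i)) 1
  | R2 (i j : Fin n) : CRel K A d (ι (Kq K) (CGen.K i) * ι (Kq K) (CGen.K j))
      (ι (Kq K) (CGen.K j) * ι (Kq K) (CGen.K i))
  | R3 (i j : Fin n) : CRel K A d
      (ι (Kq K) (CGen.K i) * ι (Kq K) (CGen.E j) * ι (Kq K) (CGen.Kinv i))
      (qi K (d i) ^ (A i j) • ι (Kq K) (CGen.E j))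
  | R4 (i j : Fin n) : CRel K A d
      (ι (Kq K) (CGen.K i) * ι (Kq K) (CGen.F j) * ι (Kq K) (CGen.Kinv i))
      (qi K (d i) ^ (-(A i j)) • ι (Kq K) (CGen.F j))
  | R5 (i j : Fin n) : CRel K A d
      (ι (Kq K) (CGen.E i) * ι (Kq K) (CGen.F j) - ι (Kq K) (CGen.F j) * ι (Kq K) (CGen.E i))
      (if i = j then (qi K (d i) - (qi K (d i))⁻¹)⁻¹ •
        (ι (Kq K) (CGen.K i) - ι (Kq K) (CGen.Kinv i)) else 0)
  | R6 (i j : Fin n) (hij : i ≠ j) : CRel K A d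
      (∑ r ∈ Finset.range ((1 - A i j).toNat + 1),
        ((-1 : Kq K) ^ r * qbin K (d i) (1 - A i j).toNat r) •
          (ι (Kq K) (CGen.E i) ^ ((1 - A i j).toNat - r) * ι (Kq K) (CGen.E j) *
            ι (Kq K) (CGen.E i) ^ r)) 0
  | R7 (i j : Fin n) (hij : i ≠ j) : CRel K A d
      (∑ r ∈ Finset.range ((1 - A i j).toNat + 1),
        ((-1 : Kq K) ^ r * qbin K (d i) (1 - A i j).toNat r) •
          (ι (Kq K) (CGen.F i) ^ ((1 - A i j).toNat - r) * ι (Kq K) (CGen.F j) *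
            ι (Kq K) (CGen.F i) ^ r)) 0

/-- The quantum group `U_q(g)` presented by generators and relations (R1)–(R7). -/
abbrev Uqg (K : Type) [Field K] {n : ℕ} (A : Matrix (Fin n) (Fin n) ℤ) (d : Fin n → ℕ) :=
  RingQuot (CRel K A d)

variable (K : Type) [Field K] {n : ℕ} (A : Matrix (Fin n) (Fin n) ℤ) (d : Fin n → ℕ)

def genE (i : Fin n) : Uqg K A d := RingQuot.mkAlgHom (Kq K) (CRel K A d) (ι (Kq K) (CGen.E i))
def genF (i : Fin n) : Uqg K A d := RingQuot.mkAlgHom (Kq K) (CRel K A d) (ι (Kq K) (CGen.F i))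
def genK (i : Fin n) : Uqg K A d := RingQuot.mkAlgHom (Kq K) (CRel K A d) (ι (Kq K) (CGen.K i))
def genKinv (i : Fin n) : Uqg K A d :=
  RingQuot.mkAlgHom (Kq K) (CRel K A d) (ι (Kq K) (CGen.Kinv i))

/-- Equitable generators `X_i, X_i⁻¹, Y_i, Z_i`. -/
inductive EGen (n : ℕ) : Type
  | X : Fin n → EGen n
  | Xinv : Fin n → EGen n
  | Y : Fin n → EGen n
  | Z : Fin n → EGen n

/-- The defining relations (E1)–(E8) of the equitable presentation. -/
inductive ERel (K : Type) [Field K] {n : ℕ} (A : Matrix (Fin n) (Fin n) ℤ) (d : Fin n → ℕ) :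
    FreeAlgebra (Kq K) (EGen n) → FreeAlgebra (Kq K) (EGen n) → Prop
  | E1a (i : Fin n) : ERel K A d (ι (Kq K) (EGen.X i) * ι (Kq K) (EGen.Xinv i)) 1
  | E1b (i : Fin n) : ERel K A d (ι (Kq K) (EGen.Xinv i) * ι (Kq K) (EGen.X i)) 1
  | E2 (i j : Fin n) : ERel K A d (ι (Kq K) (EGen.X i) * ι (Kq K) (EGen.X j))
      (ι (Kq K) (EGen.X j) * ι (Kq K) (EGen.X i))
  | E3 (i j : Fin n) : ERel K A d
      (ι (Kq K) (EGen.Y i) * ι (Kq K) (EGen.X j) -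
        qi K (d i) ^ (A i j) • (ι (Kq K) (EGen.X j) * ι (Kq K) (EGen.Y i)))
      ((1 - qi K (d i) ^ (A i j)) • (ι (Kq K) (EGen.Xinv i) * ι (Kq K) (EGen.X j)))
  | E4 (i j : Fin n) : ERel K A d
      (ι (Kq K) (EGen.X i) * ι (Kq K) (EGen.Z j) -
        qi K (d i) ^ (A i j) • (ι (Kq K) (EGen.Z j) * ι (Kq K) (EGen.X i)))
      ((1 - qi K (d i) ^ (A i j)) • (ι (Kq K) (EGen.X i) * ι (Kq K) (EGen.Xinv j)))
  | E5 (i : Fin n) : ERel K A d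
      (ι (Kq K) (EGen.Z i) * ι (Kq K) (EGen.Y i) -
        (qi K (d i) ^ 2) • (ι (Kq K) (EGen.Y i) * ι (Kq K) (EGen.Z i)))
      ((1 - qi K (d i) ^ 2) • 1)
  | E6 (i j : Fin n) (hij : i ≠ j) : ERel K A d
      (ι (Kq K) (EGen.Z i) * ι (Kq K) (EGen.Y j) -
        qi K (d i) ^ (A i j) • (ι (Kq K) (EGen.Y j) * ι (Kq K) (EGen.Z i)))
      ((1 - qi K (d i) ^ (A i j)) • (ι (Kq K) (EGen.Xinv i) * ι (Kq K) (EGen.Xinv j)))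
  | E7 (i j : Fin n) (hij : i ≠ j) : ERel K A d
      (∑ r ∈ Finset.range ((1 - A i j).toNat + 1),
        ((-1 : Kq K) ^ r * qbin K (d i) (1 - A i j).toNat r) •
          (ι (Kq K) (EGen.Y i) ^ ((1 - A i j).toNat - r) * ι (Kq K) (EGen.Y j) *
            ι (Kq K) (EGen.Y i) ^ r))
      ((∏ s ∈ Finset.range ((-(A i j)).toNat + 1), (1 - qi K (d i) ^ (A i j + 2 * (s : ℤ)))) •
        (ι (Kq K) (EGen.Xinv i) ^ (1 - A i j).toNat * ι (Kq K) (EGen.Xinv j)))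
  | E8 (i j : Fin n) (hij : i ≠ j) : ERel K A d
      (∑ r ∈ Finset.range ((1 - A i j).toNat + 1),
        ((-1 : Kq K) ^ r * qbin K (d i) (1 - A i j).toNat r) •
          (ι (Kq K) (EGen.Z i) ^ ((1 - A i j).toNat - r) * ι (Kq K) (EGen.Z j) *
            ι (Kq K) (EGen.Z i) ^ r))
      ((∏ s ∈ Finset.range ((-(A i j)).toNat + 1), (1 - qi K (d i) ^ (A i j + 2 * (s : ℤ)))) •
        (ι (Kq K) (EGen.Xinv i) ^ (1 - A i j).toNat * ι (Kq K) (EGen.Xinv j)))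

/-- The equitable algebra `U` presented by generators and relations (E1)–(E8). -/
abbrev Ueqg (K : Type) [Field K] {n : ℕ} (A : Matrix (Fin n) (Fin n) ℤ) (d : Fin n → ℕ) :=
  RingQuot (ERel K A d)

def genX (i : Fin n) : Ueqg K A d := RingQuot.mkAlgHom (Kq K) (ERel K A d) (ι (Kq K) (EGen.X i))
def genXinv (i : Fin n) : Ueqg K A d :=
  RingQuot.mkAlgHom (Kq K) (ERel K A d) (ι (Kq K) (EGen.Xinv i))
def genY (i : Fin n) : Ueqg K A d := RingQuot.mkAlgHom (Kq K) (ERel K A d) (ι (Kq K) (EGen.Y i))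
def genZ (i : Fin n) : Ueqg K A d := RingQuot.mkAlgHom (Kq K) (ERel K A d) (ι (Kq K) (EGen.Z i))

/-- `A` is a symmetrizable generalized Cartan matrix with symmetrizing positive,
relatively prime integers `d_i`, and `n ≥ 1`. -/
def IsSymmetrizableGCM {n : ℕ} (A : Matrix (Fin n) (Fin n) ℤ) (d : Fin n → ℕ) : Prop :=
  0 < n ∧ (∀ i, A i i = 2) ∧ (∀ i j, i ≠ j → A i j ≤ 0) ∧
    (∀ i, 0 < d i) ∧ Finset.univ.gcd d = 1 ∧
    (∀ i j, (d i : ℤ) * A i j = (d j : ℤ) * A j i)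

end

section QuantumIntegers

variable {K : Type} [Field K]

lemma qi_ne_zero (di : ℕ) : qi K di ≠ 0 :=
  pow_ne_zero _ RatFunc.X_ne_zero

lemma qv_pow_ne_one {m : ℕ} (hm : 0 < m) : qv K ^ m ≠ 1 := by
  intro h
  have h' : algebraMap (Polynomial K) (RatFunc K) (Polynomial.X ^ m) =
      algebraMap (Polynomial K) (RatFunc K) 1 := by
    rw [map_pow, RatFunc.algebraMap_X, map_one]
    exact h
  have h2 := congrArg Polynomial.natDegree (RatFunc.algebraMap_injective K h')
  rw [Polynomial.natDegree_X_pow, Polynomial.natDegree_one] at h2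
  omega

lemma qi_zpow_sub_ne_zero {di : ℕ} (hd : 0 < di) {m : ℕ} (hm : 0 < m) :
    qi K di ^ (m : ℤ) - qi K di ^ (-(m : ℤ)) ≠ 0 := by
  intro h
  have hq := qi_ne_zero (K := K) di
  rw [zpow_neg, zpow_natCast, sub_eq_zero, ← mul_eq_one_iff_eq_inv₀ (pow_ne_zero _ hq), ← pow_add,
    qi, ← pow_mul] at h
  exact qv_pow_ne_one (by positivity) h

lemma qi_sub_inv_ne_zero {di : ℕ} (hd : 0 < di) : qi K di - (qi K di)⁻¹ ≠ 0 := by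
  simpa using qi_zpow_sub_ne_zero (K := K) hd one_pos

lemma qnum_ne_zero {di : ℕ} (hd : 0 < di) (m : ℕ) : qnum K di ((m : ℤ) + 1) ≠ 0 := by
  have h := qi_zpow_sub_ne_zero (K := K) hd m.succ_pos
  push_cast at h
  exact div_ne_zero h (qi_sub_inv_ne_zero hd)

lemma qfac_ne_zero {di : ℕ} (hd : 0 < di) (m : ℕ) : qfac K di m ≠ 0 := by
  induction m with
  | zero => exact one_ne_zero
  | succ m ih => exact mul_ne_zero (qnum_ne_zero hd m) ih

lemma qnum_add {di : ℕ} (p : Kq K) (hp : p = qi K di ∨ p = (qi K di)⁻¹) (a b : ℤ) :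
    qnum K di (a + b) = p ^ (-a) * qnum K di b + p ^ b * qnum K di a := by
  have hq := qi_ne_zero (K := K) di
  rcases hp with rfl | rfl
  · simp only [qnum, neg_add, zpow_add₀ hq]
    ring
  · simp only [qnum, neg_add, zpow_add₀ hq, inv_zpow', neg_neg]
    ring

lemma qbin_zero_right {di : ℕ} (hd : 0 < di) (s : ℕ) : qbin K di s 0 = 1 := by
  have h := qfac_ne_zero (K := K) hd s
  simp [qbin, qfac, h]

lemma qbin_self {di : ℕ} (hd : 0 < di) (s : ℕ) : qbin K di s s = 1 := by
  have h := qfac_ne_zero (K := K) hd s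
  simp [qbin, qfac, h]

/-- The Pascal recursion for Gaussian binomials, valid for `p = q_i` and for `p = q_i⁻¹`. -/
lemma qbin_succ_succ {di : ℕ} (hd : 0 < di) (p : Kq K)
    (hp : p = qi K di ∨ p = (qi K di)⁻¹) {s r : ℕ} (hr : r < s) :
    qbin K di (s + 1) (r + 1) =
      p ^ (-((r : ℤ) + 1)) * qbin K di s (r + 1) + p ^ ((s : ℤ) - r) * qbin K di s r := by
  obtain ⟨t, rfl⟩ := Nat.exists_eq_add_of_lt hr
  have e1 : r + t + 1 + 1 - (r + 1) = t + 1 := by omega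
  have e2 : r + t + 1 - (r + 1) = t := by omega
  have e3 : r + t + 1 - r = t + 1 := by omega
  have e4 : ((r + t + 1 : ℕ) : ℤ) - r = t + 1 := by push_cast; ring
  have e5 : ((r + t + 1 : ℕ) : ℤ) + 1 = (r + 1) + (t + 1) := by push_cast; ring
  have hsum := qnum_add p hp ((r : ℤ) + 1) ((t : ℤ) + 1)
  have hr0 := qnum_ne_zero (K := K) hd r
  have ht0 := qnum_ne_zero (K := K) hd t
  have hfr := qfac_ne_zero (K := K) hd r
  have hft := qfac_ne_zero (K := K) hd t
  have hF : qfac K di (r + t + 1 + 1) =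
      qnum K di ((r + 1) + (t + 1)) * qfac K di (r + t + 1) := by
    rw [← e5]; rfl
  have hFr : qfac K di (r + 1) = qnum K di (r + 1) * qfac K di r := rfl
  have hFt : qfac K di (t + 1) = qnum K di (t + 1) * qfac K di t := rfl
  simp only [qbin, e1, e2, e3, e4, hF, hFr, hFt, hsum]
  generalize qfac K di (r + t + 1) = F
  generalize p ^ (-((r : ℤ) + 1)) = u
  generalize p ^ ((t : ℤ) + 1) = w
  field_simp

end QuantumIntegers

section IteratedCommutator

variable {F R : Type*} [Field F] [Ring R] [Algebra F R]

/-- The iterated `q`-commutator `∏_{k < s} (L_y - a p^{2k} R_y)` applied to `v`, where `L_y` and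
`R_y` are left and right multiplication by `y`. -/
def qCommIter (a p : F) (y v : R) : ℕ → R
  | 0 => v
  | s + 1 => y * qCommIter a p y v s - (a * p ^ (2 * s)) • (qCommIter a p y v s * y)

/-- The noncommutative `q`-binomial theorem, for any coefficients obeying the Pascal recursion. -/
lemma qCommIter_eq_sum (a p : F) (hp : p ≠ 0) (y v : R) (b : ℕ → ℕ → F)
    (hb0 : ∀ s, b s 0 = 1) (hb : ∀ s r, s < r → b s r = 0)
    (hbs : ∀ s r, b (s + 1) (r + 1) =
      p ^ (-((r : ℤ) + 1)) * b s (r + 1) + p ^ ((s : ℤ) - r) * b s r) (s : ℕ) :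
    qCommIter a p y v s = ∑ r ∈ Finset.range (s + 1),
      ((-1) ^ r * b s r * (a ^ r * p ^ (((s : ℤ) - 1) * r))) • (y ^ (s - r) * v * y ^ r) := by
  induction s with
  | zero => simp [qCommIter, hb0]
  | succ s ih =>
    have hL : y * qCommIter a p y v s = ∑ r ∈ Finset.range (s + 1 + 1),
        ((-1) ^ r * b s r * (a ^ r * p ^ (((s : ℤ) - 1) * r))) •
          (y ^ (s + 1 - r) * v * y ^ r) := by
      rw [Finset.sum_range_succ, hb s (s + 1) s.lt_succ_self, ih, Finset.mul_sum]
      simp only [mul_zero, zero_mul, zero_smul, add_zero]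
      refine Finset.sum_congr rfl fun r hr => ?_
      have hr' : s + 1 - r = (s - r) + 1 := by
        have := Finset.mem_range.mp hr
        omega
      rw [hr', pow_succ', mul_smul_comm]
      simp only [mul_assoc]
    have hR : qCommIter a p y v s * y = ∑ r ∈ Finset.range (s + 1),
        ((-1) ^ r * b s r * (a ^ r * p ^ (((s : ℤ) - 1) * r))) •
          (y ^ (s + 1 - (r + 1)) * v * y ^ (r + 1)) := by
      rw [ih, Finset.sum_mul]
      refine Finset.sum_congr rfl fun r _ => ?_
      rw [Nat.add_sub_add_right, pow_succ, smul_mul_assoc]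
      simp only [mul_assoc]
    rw [qCommIter, hR, hL, Finset.sum_range_succ', Finset.sum_range_succ' _ (s + 1),
      Finset.smul_sum, add_sub_right_comm, ← Finset.sum_sub_distrib]
    congr 1
    · refine Finset.sum_congr rfl fun r _ => ?_
      rw [smul_smul, ← sub_smul]
      congr 1
      have e1 : p ^ (((s : ℤ) - 1) * ((r + 1 : ℕ) : ℤ)) =
          p ^ ((((s + 1 : ℕ) : ℤ) - 1) * ((r + 1 : ℕ) : ℤ)) * p ^ (-((r : ℤ) + 1)) := by
        rw [← zpow_add₀ hp]; congr 1; push_cast; ring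
      have e2 : p ^ (2 * s) * p ^ (((s : ℤ) - 1) * (r : ℤ)) =
          p ^ ((((s + 1 : ℕ) : ℤ) - 1) * ((r + 1 : ℕ) : ℤ)) * p ^ ((s : ℤ) - r) := by
        rw [← zpow_natCast, ← zpow_add₀ hp, ← zpow_add₀ hp]; congr 1; push_cast; ring
      rw [hbs, e1]
      linear_combination (-(a * (-1) ^ r * b s r * a ^ r)) * e2
    · simp [hb0]

lemma sub_qCommute {c : F} {x y z : R} (hzx : Commute z x)
    (h : y * z - c • (z * y) = (1 - c) • (x * z)) : (y - x) * z = c • (z * (y - x)) := by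
  rw [sub_mul, mul_sub, hzx.eq, eq_add_of_sub_eq h]
  module

lemma qCommIter_add (a p : F) (y v w : R) (s : ℕ) :
    qCommIter a p y (v + w) s = qCommIter a p y v s + qCommIter a p y w s := by
  induction s with
  | zero => rfl
  | succ s ih =>
    simp only [qCommIter, ih, mul_add, add_mul, smul_add]
    abel

lemma pow_mul_of_qCommute {p : F} {e x : R} (hex : e * x = p ^ 2 • (x * e)) (s : ℕ) :
    e * x ^ s = p ^ (2 * s) • (x ^ s * e) := by
  induction s with
  | zero => simp
  | succ s ih =>
    rw [pow_succ, ← mul_assoc, ih, smul_mul_assoc, mul_assoc, hex, mul_smul_comm, smul_smul,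
      ← mul_assoc]
    congr 1
    ring

lemma qCommIter_add_of_commute {a p : F} {e x w : R} (hxw : x * w = w * x)
    (hew : e * w = a • (w * e)) (hex : e * x = p ^ 2 • (x * e)) (s : ℕ) :
    qCommIter a p (e + x) w s = (∏ k ∈ Finset.range s, (1 - a * p ^ (2 * k))) • (x ^ s * w) := by
  induction s with
  | zero => simp [qCommIter]
  | succ s ih =>
    have h1 : e * (x ^ s * w) = (a * p ^ (2 * s)) • (x ^ s * w * e) := by
      rw [← mul_assoc, pow_mul_of_qCommute hex, smul_mul_assoc, mul_assoc, hew, mul_smul_comm,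
        smul_smul, mul_assoc, mul_comm]
    have h2 : x * (x ^ s * w) = x ^ (s + 1) * w := by rw [pow_succ', mul_assoc]
    have h3 : x ^ s * w * x = x ^ (s + 1) * w := by rw [mul_assoc, ← hxw, pow_succ, mul_assoc]
    rw [qCommIter, ih, mul_smul_comm, smul_mul_assoc, add_mul, mul_add, h1, h2, h3,
      Finset.prod_range_succ]
    module

lemma qCommute_qCommIter {a p : F} {e x f : R} (hxf : x * f = a • (f * x))
    (hxe : x * e = p ^ 2 • (e * x)) (s : ℕ) :
    x * qCommIter a p e f s = (a * p ^ (2 * s)) • (qCommIter a p e f s * x) := by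
  induction s with
  | zero => simpa [qCommIter] using hxf
  | succ s ih =>
    set T := qCommIter a p e f s
    have h1 : x * (e * T) = (a * p ^ (2 * (s + 1))) • (e * T * x) := by
      rw [← mul_assoc, hxe, smul_mul_assoc, mul_assoc, ih, mul_smul_comm, smul_smul, mul_assoc]
      congr 1
      ring
    have h2 : x * (T * e) = (a * p ^ (2 * (s + 1))) • (T * e * x) := by
      rw [← mul_assoc, ih, smul_mul_assoc, mul_assoc, hxe, mul_smul_comm, smul_smul, ← mul_assoc]
      congr 1
      ring
    rw [qCommIter, mul_sub, mul_smul_comm, h1, h2, sub_mul, smul_mul_assoc, smul_sub,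
      smul_comm]

lemma qCommIter_add_left {a p : F} {e x f : R} (hxf : x * f = a • (f * x))
    (hxe : x * e = p ^ 2 • (e * x)) (s : ℕ) :
    qCommIter a p (e + x) f s = qCommIter a p e f s := by
  induction s with
  | zero => rfl
  | succ s ih =>
    rw [qCommIter, ih, add_mul, mul_add, qCommute_qCommIter hxf hxe, qCommIter, smul_add]
    abel

end IteratedCommutator

/-- The `q`-Serre sum is an iterated `q`-commutator, with parameter `p = q_i` or `p = q_i⁻¹`. -/
lemma serre_sum_eq_qCommIter {K : Type} [Field K] {R : Type*} [Ring R] [Algebra (Kq K) R]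
    {di : ℕ} (hd : 0 < di) (p : Kq K) (hp : p = qi K di ∨ p = (qi K di)⁻¹) (y v : R) (m : ℕ) :
    ∑ r ∈ Finset.range (m + 1), ((-1 : Kq K) ^ r * qbin K di m r) • (y ^ (m - r) * v * y ^ r) =
      qCommIter (p ^ (1 - (m : ℤ))) p y v m := by
  have hq := qi_ne_zero (K := K) di
  have hp0 : p ≠ 0 := by
    rcases hp with rfl | rfl
    · exact hq
    · exact inv_ne_zero hq
  rw [qCommIter_eq_sum _ p hp0 y v (fun s r => if r ≤ s then qbin K di s r else 0)]
  · refine Finset.sum_congr rfl fun r hr => ?_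
    have hr' : r ≤ m := Nat.lt_succ_iff.mp (Finset.mem_range.mp hr)
    have h1 : (p ^ (1 - (m : ℤ))) ^ r * p ^ (((m : ℤ) - 1) * r) = 1 := by
      rw [← zpow_natCast, ← zpow_mul, ← zpow_add₀ hp0, ← add_mul]
      simp
    rw [h1, if_pos hr', mul_one]
  · intro s
    simp [qbin_zero_right hd]
  · intro s r h
    simp [not_le.mpr h]
  · intro s r
    rcases lt_trichotomy r s with h | rfl | h
    · rw [if_pos (by omega), if_pos (by omega), if_pos h.le, qbin_succ_succ hd p hp h]
    · simp [qbin_self hd]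
    · rw [if_neg (by omega), if_neg (by omega), if_neg (by omega)]
      simp

section Equitable

variable {K : Type} [Field K] {n : ℕ} {A : Matrix (Fin n) (Fin n) ℤ} {d : Fin n → ℕ}

lemma genX_mul_genXinv (i : Fin n) : genX K A d i * genXinv K A d i = 1 := by
  simpa [genX, genXinv] using RingQuot.mkAlgHom_rel (Kq K) (ERel.E1a (K := K) (A := A) (d := d) i)

lemma genXinv_mul_genX (i : Fin n) : genXinv K A d i * genX K A d i = 1 := by
  simpa [genX, genXinv] using RingQuot.mkAlgHom_rel (Kq K) (ERel.E1b (K := K) (A := A) (d := d) i)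

lemma genX_comm (i j : Fin n) : Commute (genX K A d i) (genX K A d j) := by
  simpa [genX, Commute, SemiconjBy] using
    RingQuot.mkAlgHom_rel (Kq K) (ERel.E2 (K := K) (A := A) (d := d) i j)

lemma genX_comm_genXinv (i j : Fin n) : Commute (genX K A d i) (genXinv K A d j) :=
  let u : (Ueqg K A d)ˣ := ⟨_, _, genX_mul_genXinv j, genXinv_mul_genX j⟩
  (show Commute (genX K A d i) (u : Ueqg K A d) from genX_comm i j).units_inv_right

lemma genXinv_comm (i j : Fin n) : Commute (genXinv K A d i) (genXinv K A d j) :=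
  let u : (Ueqg K A d)ˣ := ⟨_, _, genX_mul_genXinv i, genXinv_mul_genX i⟩
  (show Commute (u : Ueqg K A d) (genXinv K A d j) from genX_comm_genXinv i j).units_inv_left

lemma genY_sub_genXinv_mul_genX (i j : Fin n) :
    (genY K A d i - genXinv K A d i) * genX K A d j =
      qi K (d i) ^ A i j • (genX K A d j * (genY K A d i - genXinv K A d i)) := by
  have h : genY K A d i * genX K A d j - qi K (d i) ^ A i j • (genX K A d j * genY K A d i) =
      (1 - qi K (d i) ^ A i j) • (genXinv K A d i * genX K A d j) := by
    simpa [genX, genXinv, genY] using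
      RingQuot.mkAlgHom_rel (Kq K) (ERel.E3 (K := K) (A := A) (d := d) i j)
  exact sub_qCommute (genX_comm_genXinv j i) h

lemma genXinv_mul_genY_sub_genXinv (i j : Fin n) :
    genXinv K A d j * (genY K A d i - genXinv K A d i) =
      qi K (d i) ^ A i j • ((genY K A d i - genXinv K A d i) * genXinv K A d j) := by
  set e := genY K A d i - genXinv K A d i with he
  have h := genY_sub_genXinv_mul_genX (K := K) (A := A) (d := d) i j
  rw [← he] at h
  calc genXinv K A d j * e
      = genXinv K A d j * (e * genX K A d j) * genXinv K A d j := by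
        rw [mul_assoc, mul_assoc, genX_mul_genXinv, mul_one]
    _ = qi K (d i) ^ A i j • (e * genXinv K A d j) := by
        rw [h, mul_smul_comm, smul_mul_assoc, ← mul_assoc, genXinv_mul_genX, one_mul]

lemma genY_serre_sum {i j : Fin n} (hij : i ≠ j) :
    ∑ r ∈ Finset.range ((1 - A i j).toNat + 1),
      ((-1 : Kq K) ^ r * qbin K (d i) (1 - A i j).toNat r) •
        (genY K A d i ^ ((1 - A i j).toNat - r) * genY K A d j * genY K A d i ^ r) =
      (∏ s ∈ Finset.range ((-(A i j)).toNat + 1), (1 - qi K (d i) ^ (A i j + 2 * (s : ℤ)))) •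
        (genXinv K A d i ^ (1 - A i j).toNat * genXinv K A d j) := by
  have h := RingQuot.mkAlgHom_rel (Kq K) (ERel.E7 (K := K) (A := A) (d := d) i j hij)
  simp only [map_sum, map_smul, map_mul, map_pow] at h
  exact h

end Equitable

/-- In the equitable algebra `U`, for `i ≠ j`,
`Σ_{r=0}^{1-A_ij} (-1)^r [1-A_ij choose r]_i (Y_i-X_i⁻¹)^{1-A_ij-r} (Y_j-X_j⁻¹) (Y_i-X_i⁻¹)^r = 0`. -/
theorem equitable_serre_sum_Y (K : Type) [Field K] {n : ℕ}
    (A : Matrix (Fin n) (Fin n) ℤ) (d : Fin n → ℕ) (hA : IsSymmetrizableGCM A d)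
    (i j : Fin n) (hij : i ≠ j) :
    ∑ r ∈ Finset.range ((1 - A i j).toNat + 1),
      ((-1 : Kq K) ^ r * qbin K (d i) (1 - A i j).toNat r) •
        ((genY K A d i - genXinv K A d i) ^ ((1 - A i j).toNat - r) *
          (genY K A d j - genXinv K A d j) *
          (genY K A d i - genXinv K A d i) ^ r) = 0 := by
  obtain ⟨-, hdiag, hneg, hd, -, hsymm⟩ := hA
  have hq := qi_ne_zero (K := K) (d i)
  obtain ⟨N, hN⟩ := Int.eq_ofNat_of_zero_le (neg_nonneg.mpr (hneg i j hij))
  have hAij : A i j = -(N : ℤ) := by omega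
  have hm : (1 - A i j).toNat = N + 1 := by omega
  have hm' : (-(A i j)).toNat = N := by omega
  have hE7 := genY_serre_sum (K := K) (A := A) (d := d) hij
  set q := qi K (d i) with hqdef
  set x := genXinv K A d i with hx
  set w := genXinv K A d j with hw
  set e := genY K A d i - x with he
  set f := genY K A d j - w with hf
  have hYi : genY K A d i = e + x := by rw [he]; abel
  have hYj : genY K A d j = f + w := by rw [hf]; abel
  have hxe : x * e = q ^ 2 • (e * x) := by
    have h := genXinv_mul_genY_sub_genXinv (K := K) (A := A) (d := d) i i
    rw [hdiag] at h
    exact_mod_cast h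
  have hwe : w * e = q ^ (-(N : ℤ)) • (e * w) := by
    rw [← hAij]
    exact genXinv_mul_genY_sub_genXinv i j
  have hxf : x * f = q ^ (-(N : ℤ)) • (f * x) := by
    have hqq : qi K (d j) ^ A j i = q ^ (-(N : ℤ)) := by
      rw [← hAij, hqdef, qi, qi, ← zpow_natCast, ← zpow_natCast, ← zpow_mul, ← zpow_mul, hsymm i j]
    rw [← hqq]
    exact genXinv_mul_genY_sub_genXinv j i
  have hex : e * x = q⁻¹ ^ 2 • (x * e) := by
    rw [hxe, smul_smul, ← mul_pow, inv_mul_cancel₀ hq, one_pow, one_smul]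
  have hew : e * w = q⁻¹ ^ (-(N : ℤ)) • (w * e) := by
    rw [hwe, smul_smul, ← mul_zpow, inv_mul_cancel₀ hq, one_zpow, one_smul]
  have hexp : 1 - ((N + 1 : ℕ) : ℤ) = -(N : ℤ) := by push_cast; ring
  have hprod : ∏ s ∈ Finset.range (N + 1), (1 - q ^ (-(N : ℤ) + 2 * (s : ℤ))) =
      ∏ k ∈ Finset.range (N + 1), (1 - q⁻¹ ^ (-(N : ℤ)) * q⁻¹ ^ (2 * k)) := by
    rw [← Finset.prod_range_reflect]
    refine Finset.prod_congr rfl fun k hk => ?_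
    have hk' : k ≤ N := Nat.lt_succ_iff.mp (Finset.mem_range.mp hk)
    rw [← zpow_natCast, ← zpow_add₀ (inv_ne_zero hq), inv_zpow']
    congr 2
    have hkN : ((N + 1 - 1 - k : ℕ) : ℤ) = N - k := by omega
    rw [hkN]
    push_cast
    ring
  have hS := fun (v : Ueqg K A d) p hp =>
    serre_sum_eq_qCommIter (K := K) (hd i) p hp (e + x) v (N + 1)
  simp only [hexp] at hS
  rw [hm, hm', hAij, hYi, hYj, hprod,
    ← qCommIter_add_of_commute (genXinv_comm i j).eq hew hex, ← hS w _ (Or.inr rfl),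
    hS _ _ (Or.inl rfl), hS _ _ (Or.inl rfl), qCommIter_add, add_eq_right,
    qCommIter_add_left hxf hxe] at hE7
  rw [hm, serre_sum_eq_qCommIter (hd i) _ (Or.inl rfl), hexp]
  exact hE7
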